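/- arXiv:1604.06957 — 5 statements merged into one kernel-verified Lean document; each statement's English description precedes it below -/
import Mathlib

section
/- Let p > 1 and α > 2 be real numbers and let a, b, c > 0 be real numbers satisfying P(a,b,c) = a/2 − b/2 − α c/(2(p+1)) = 0 and R(a,b,c) = a + 3b − α(α−1)c/(p+1) ≤ 0. Then for every λ > 1 one has (i) (λ²a)/2 − (λ⁻²b)/2 − (α/(2(p+1)))·λ^α c < 0, and (ii) λ²a/2 + λ⁻²b/2 − λ^α c/(p+1) < a/2 + b/2 − c/(p+1). (In the paper's notation: P(φ_ω^λ) < 0 and E(φ_ω^λ) < E(φ_ω) for all λ > 1, so that φ_ω^λ ∈ B_ω.) -/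
/-- The elementary inequality behind the sign of the virial functional along the scaling. -/
theorem sub_two_div_four_mul_lt_rpow_sub_sq {α x : ℝ} (hα : 2 < α) (hx : 1 < x) :
    (α - 2) / 4 * (x ^ 2 - (x ^ 2)⁻¹) < x ^ α - x ^ 2 := by
  have hx0 : 0 < x := by linarith
  have hL : 0 < Real.log x := Real.log_pos hx
  have hpow : x ^ α = x ^ 2 * x ^ (α - 2) := by
    rw [← Real.rpow_natCast x 2, ← Real.rpow_add hx0]
    norm_num
  have hexp : (α - 2) * Real.log x + 1 < x ^ (α - 2) := by
    rw [Real.rpow_def_of_pos hx0, mul_comm (Real.log x)]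
    exact Real.add_one_lt_exp (mul_pos (by linarith) hL).ne'
  have hlog : 1 - (x ^ 4)⁻¹ ≤ 4 * Real.log x := by
    have h := Real.one_sub_inv_le_log_of_pos (pow_pos hx0 4)
    rwa [Real.log_pow, Nat.cast_ofNat] at h
  have hmul : (α - 2) / 4 * (1 - (x ^ 4)⁻¹) ≤ (α - 2) / 4 * (4 * Real.log x) :=
    mul_le_mul_of_nonneg_left hlog (by linarith)
  calc (α - 2) / 4 * (x ^ 2 - (x ^ 2)⁻¹)
      = x ^ 2 * ((α - 2) / 4 * (1 - (x ^ 4)⁻¹)) := by field_simp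
    _ < x ^ 2 * (x ^ (α - 2) - 1) := mul_lt_mul_of_pos_left (by linarith) (pow_pos hx0 2)
    _ = x ^ α - x ^ 2 := by rw [hpow]; ring

/-- Twice the virial functional is negative along the scaling, with `d` the normalized
potential energy. -/
theorem scaled_virial_neg {α a b d x : ℝ} (hα : 2 < α) (hd : 0 < d)
    (hP : a - b = α * d) (hR : a + 3 * b ≤ α * (α - 1) * d) (hx : 1 < x) :
    x ^ 2 * a - (x ^ 2)⁻¹ * b - α * d * x ^ α < 0 := by
  have hb : b ≤ α * d * ((α - 2) / 4) := by linarith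
  have hsq : 1 < x ^ 2 := one_lt_pow₀ hx two_ne_zero
  have hinv : (x ^ 2)⁻¹ < 1 := inv_lt_one_of_one_lt₀ hsq
  have h₁ := mul_le_mul_of_nonneg_right hb (by linarith : 0 ≤ x ^ 2 - (x ^ 2)⁻¹)
  have h₂ := mul_lt_mul_of_pos_left (sub_two_div_four_mul_lt_rpow_sub_sq hα hx)
    (mul_pos (by linarith) hd : 0 < α * d)
  obtain rfl : a = b + α * d := by linarith
  linarith

/-- The energy strictly decreases along the scaling. -/
theorem scaled_energy_lt {α a b d x : ℝ} (hα : 2 < α) (hd : 0 < d)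
    (hP : a - b = α * d) (hR : a + 3 * b ≤ α * (α - 1) * d) (hx : 1 < x) :
    x ^ 2 * a / 2 + (x ^ 2)⁻¹ * b / 2 - x ^ α * d < a / 2 + b / 2 - d := by
  have hderiv : ∀ y : ℝ, 1 ≤ y →
      HasDerivAt (fun y : ℝ => y ^ 2 * a / 2 + (y ^ 2)⁻¹ * b / 2 - y ^ α * d)
        ((y ^ 2 * a - (y ^ 2)⁻¹ * b - α * d * y ^ α) / y) y := by
    intro y hy
    have hy0 : 0 < y := by linarith
    have hsq : HasDerivAt (fun y : ℝ => y ^ 2) (2 * y) y := by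
      simpa using hasDerivAt_pow 2 y
    refine ((((hsq.mul_const a).div_const 2).add
      (((hsq.fun_inv (pow_pos hy0 2).ne').mul_const b).div_const 2)).sub
      ((Real.hasDerivAt_rpow_const (p := α) (Or.inl hy0.ne')).mul_const d)).congr_deriv ?_
    rw [Real.rpow_sub_one hy0.ne']
    field_simp
    ring
  have hanti : StrictAntiOn
      (fun y : ℝ => y ^ 2 * a / 2 + (y ^ 2)⁻¹ * b / 2 - y ^ α * d) (Set.Ici 1) := by
    refine strictAntiOn_of_deriv_neg (convex_Ici 1)
      (fun y hy => (hderiv y hy).continuousAt.continuousWithinAt) fun y hy => ?_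
    rw [interior_Ici, Set.mem_Ioi] at hy
    rw [(hderiv y hy.le).deriv]
    exact div_neg_of_neg_of_pos (scaled_virial_neg hα hd hP hR hy) (by linarith)
  simpa using hanti Set.self_mem_Ici hx.le hx

/-- scalar content of Lemma 2.1: if `P(a,b,c) = 0` and `R(a,b,c) ≤ 0`
then for every `λ > 1` one has `P(λ²a, λ⁻²b, λ^α c) < 0` and
`E(λ²a, λ⁻²b, λ^α c) < E(a,b,c)`. -/
theorem stmt2 (p α a b c : ℝ) (hp : 1 < p) (hα : 2 < α)
    (ha : 0 < a) (hb : 0 < b) (hc : 0 < c)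
    (hP : a / 2 - b / 2 - α * c / (2 * (p + 1)) = 0)
    (hR : a + 3 * b - α * (α - 1) * c / (p + 1) ≤ 0) :
    ∀ lam : ℝ, 1 < lam →
      (lam ^ 2 * a) / 2 - ((lam ^ 2)⁻¹ * b) / 2 - (α / (2 * (p + 1))) * (lam ^ α * c) < 0 ∧
      lam ^ 2 * a / 2 + (lam ^ 2)⁻¹ * b / 2 - lam ^ α * c / (p + 1)
        < a / 2 + b / 2 - c / (p + 1) := by
  intro lam hlam
  have hp0 : p + 1 ≠ 0 := by linarith
  have hd : 0 < c / (p + 1) := div_pos hc (by linarith)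
  have hP' : a - b = α * (c / (p + 1)) := by
    have h : α * c / (2 * (p + 1)) = α * (c / (p + 1)) / 2 := by field_simp
    linarith
  have hR' : a + 3 * b ≤ α * (α - 1) * (c / (p + 1)) := by
    rw [← mul_div_assoc]
    linarith
  constructor
  · have h : α / (2 * (p + 1)) * (lam ^ α * c) = α * (c / (p + 1)) * lam ^ α / 2 := by
      field_simp
    linarith [scaled_virial_neg hα hd hP' hR' hlam]
  · rw [mul_div_assoc (lam ^ α)]
    exact scaled_energy_lt hα hd hP' hR' hlam
end

section
/- For every real number α > 2 and every real λ with 0 < λ ≤ 1, one has α(α−2)·(λ − λ⁻¹)²·λ^α ≤ 4·(2λ^α − αλ² + α − 2), where λ^α denotes the real power. -/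
theorem rpow_mul_one_add_le_one {c s : ℝ} (hc : 0 ≤ c) (hs : 0 < s) :
    s ^ c * (1 + c * (1 - s)) ≤ 1 := by
  have hlog := mul_le_mul_of_nonneg_left (Real.log_le_sub_one_of_pos hs) hc
  have hexp := Real.add_one_le_exp (-(c * Real.log s))
  calc s ^ c * (1 + c * (1 - s))
      ≤ s ^ c * Real.exp (-(c * Real.log s)) := by gcongr; linarith
    _ = 1 := by rw [Real.rpow_def_of_pos hs, ← Real.exp_add, mul_comm (Real.log s), add_neg_cancel,
                  Real.exp_zero]

theorem sq_mul_rpow_sub_one_le_bernoulli_gap {b s : ℝ} (hb : 1 ≤ b) (hs : 0 < s) (hs1 : s ≤ 1) :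
    b * (b - 1) * (1 - s) ^ 2 * s ^ (b - 1) ≤ 2 * (s ^ b - b * s + b - 1) := by
  let F : ℝ → ℝ := fun t ↦ 2 * (t ^ b - b * t + b - 1) - b * (b - 1) * (1 - t) ^ 2 * t ^ (b - 1)
  have hF : ∀ t, 0 < t → HasDerivAt F
      (2 * (b * t ^ (b - 1) - b) - (b * (b - 1) * (-2 * (1 - t)) * t ^ (b - 1)
        + b * (b - 1) * (1 - t) ^ 2 * ((b - 1) * t ^ (b - 1 - 1)))) t := by
    intro t ht
    have hpow (p : ℝ) := Real.hasDerivAt_rpow_const (p := p) (Or.inl ht.ne')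
    have hsq := (((hasDerivAt_id t).const_sub 1).pow 2).const_mul (b * (b - 1))
    have hlin := (((hpow b).sub ((hasDerivAt_id t).const_mul b)).add_const b).sub_const 1
    refine ((hlin.const_mul 2).sub (hsq.mul (hpow (b - 1)))).congr_deriv ?_
    simp
  have hanti : AntitoneOn F (Set.Icc s 1) := by
    refine antitoneOn_of_deriv_nonpos (convex_Icc s 1)
      (fun t ht ↦ (hF t (hs.trans_le ht.1)).continuousAt.continuousWithinAt) ?_ ?_ <;>
    · rw [interior_Icc]
      intro t ht
      have ht0 : 0 < t := hs.trans ht.1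
      first
      | exact (hF t ht0).differentiableAt.differentiableWithinAt
      | rw [(hF t ht0).deriv]
        have hle := rpow_mul_one_add_le_one (sub_nonneg.2 hb) ht0
        have hprod := mul_le_mul_of_nonneg_left hle (by linarith : 0 ≤ 2 * b)
        have hnonneg : 0 ≤ b * (b - 1) * (1 - t) ^ 2 * ((b - 1) * t ^ (b - 1 - 1)) := by
          have := sub_nonneg.2 hb
          positivity
        linarith
  have h := hanti (Set.left_mem_Icc.2 hs1) (Set.right_mem_Icc.2 hs1) hs1
  have h1 : F 1 = 0 := by simp [F]
  rw [h1] at h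
  exact sub_nonneg.1 h

/-- inequality (3.9) of the paper: for `α > 2` and `0 < λ ≤ 1`,
`α(α−2)(λ − λ⁻¹)²λ^α ≤ 4(2λ^α − αλ² + α − 2)`. -/
theorem stmt4 (α lam : ℝ) (hα : 2 < α) (hlam : 0 < lam) (hlam1 : lam ≤ 1) :
    α * (α - 2) * (lam - lam⁻¹) ^ 2 * lam ^ α
      ≤ 4 * (2 * lam ^ α - α * lam ^ 2 + α - 2) := by
  have h := sq_mul_rpow_sub_one_le_bernoulli_gap (b := α / 2) (by linarith)
    (pow_pos hlam 2) (pow_le_one₀ hlam.le hlam1)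
  have hpow : (lam ^ 2) ^ (α / 2) = lam ^ α := by
    rw [← Real.rpow_natCast_mul hlam.le]
    congr 1
    push_cast
    ring
  rw [Real.rpow_sub_one (pow_pos hlam 2).ne', hpow] at h
  have hleft : α * (α - 2) * (lam - lam⁻¹) ^ 2 * lam ^ α
      = 4 * (α / 2 * (α / 2 - 1) * (1 - lam ^ 2) ^ 2 * (lam ^ α / lam ^ 2)) := by
    field_simp
    ring
  linarith
end

section
/- For every real number β > 1 and every real s with 0 < s ≤ 1, one has s^β − 1 − β(s−1) − (β(β−1)/2)·(s−1)²·s^{β−1} ≥ 0, where powers are real powers. -/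
/-- A Bernoulli-type bound: `x ^ (-γ) ≥ 1 + γ * (1 - x)`, multiplied through by `x ^ γ`. -/
lemma rpow_mul_one_add_mul_one_sub_le_one {γ x : ℝ} (hγ : 0 ≤ γ) (hx : 0 < x) :
    x ^ γ * (1 + γ * (1 - x)) ≤ 1 := by
  have hlog : 1 + γ * (1 - x) ≤ x ^ (-γ) := by
    rw [Real.rpow_def_of_pos hx]
    nlinarith [Real.add_one_le_exp (Real.log x * -γ), Real.log_le_sub_one_of_pos hx]
  calc x ^ γ * (1 + γ * (1 - x)) ≤ x ^ γ * x ^ (-γ) := by gcongr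
    _ = 1 := by rw [← Real.rpow_add hx, add_neg_cancel, Real.rpow_zero]

/-- for `β > 1` and `0 < s ≤ 1`,
`s^β − 1 − β(s−1) − (β(β−1)/2)(s−1)² s^{β−1} ≥ 0`. -/
theorem stmt5 (β s : ℝ) (hβ : 1 < β) (hs : 0 < s) (hs1 : s ≤ 1) :
    s ^ β - 1 - β * (s - 1) - (β * (β - 1) / 2) * (s - 1) ^ 2 * s ^ (β - 1) ≥ 0 := by
  -- Freeze the factor `s ^ (β - 1)`: the resulting function of `x` decreases to `0` on `[s, 1]`.
  set c := s ^ (β - 1)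
  let h : ℝ → ℝ := fun x ↦ x ^ β - 1 - β * (x - 1) - (β * (β - 1) / 2) * (x - 1) ^ 2 * c
  have hderiv (x : ℝ) :
      HasDerivAt h (β * (x ^ (β - 1) - 1 - (β - 1) * (x - 1) * c)) x := by
    have hlin : HasDerivAt (fun y : ℝ ↦ y - 1) 1 x := (hasDerivAt_id x).sub_const 1
    convert! (((Real.hasDerivAt_rpow_const (Or.inr hβ.le)).sub_const 1).sub
      (hlin.const_mul β)).sub (((hlin.pow 2).const_mul (β * (β - 1) / 2)).mul_const c) using 1
    push_cast
    ring
  have hanti : AntitoneOn h (Set.Icc s 1) := by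
    refine antitoneOn_of_deriv_nonpos (convex_Icc s 1)
      (fun x _ ↦ (hderiv x).continuousAt.continuousWithinAt)
      (fun x _ ↦ (hderiv x).differentiableAt.differentiableWithinAt) fun x hx ↦ ?_
    rw [interior_Icc] at hx
    rw [(hderiv x).deriv]
    have hcx : c ≤ x ^ (β - 1) := Real.rpow_le_rpow hs.le hx.1.le (by linarith)
    have hbound := rpow_mul_one_add_mul_one_sub_le_one (sub_nonneg.2 hβ.le) (hs.trans hx.1)
    have hmul := mul_le_mul_of_nonneg_left hcx
      (mul_nonneg (sub_nonneg.2 hβ.le) (sub_nonneg.2 hx.2.le))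
    exact mul_nonpos_of_nonneg_of_nonpos (by linarith) (by linarith)
  have hle : h 1 ≤ h s := hanti ⟨le_rfl, hs1⟩ ⟨hs1, le_rfl⟩ hs1
  have hone : h 1 = 0 := by simp [h]
  exact hone ▸ hle
end

section
/- Let p > 1 and α > 2 be real numbers. Let b₀, c₀ > 0 be real numbers with 4(p+1)·b₀ ≤ α(α−2)·c₀. Let b, c be real numbers with 0 ≤ b ≤ b₀ and c ≥ c₀, and set λ₀ = (c₀/c)^{1/α} (real power). Then (p+1)·(λ₀² + λ₀⁻² − 2)·b ≤ (2λ₀^α − αλ₀² + α − 2)·c. -/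
/-- The derivative bound behind `rpow_taylor_lower_bound`, obtained from the Bernoulli inequality. -/
lemma one_add_le_mul_rpow_neg {β s : ℝ} (hβ : 1 < β) (hs : 0 < s) (hs1 : s ≤ 1) :
    1 + β * (β - 1) * (1 - s) ≤ (1 + β * (β - 2) * (1 - s)) * s ^ (-β) := by
  have bernoulli : 1 + β * (s⁻¹ - 1) ≤ s ^ (-β) := by
    have h := one_add_mul_self_le_rpow_one_add (s := s⁻¹ - 1)
      (by linarith [inv_pos.mpr hs]) hβ.le
    rwa [add_sub_cancel, Real.inv_rpow hs.le, ← Real.rpow_neg hs.le] at h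
  have hnonneg : 0 ≤ 1 + β * (β - 2) * (1 - s) := by
    nlinarith [mul_nonneg (sq_nonneg (β - 1)) (sub_nonneg.mpr hs1)]
  refine le_trans ?_ (mul_le_mul_of_nonneg_left bernoulli hnonneg)
  have hdiff : (1 + β * (β - 2) * (1 - s)) * (1 + β * (s⁻¹ - 1))
      - (1 + β * (β - 1) * (1 - s)) = β * (β - 1) ^ 2 * (1 - s) ^ 2 / s := by
    field_simp
    ring
  have : 0 ≤ β * (β - 1) ^ 2 * (1 - s) ^ 2 / s := by positivity
  linarith

/-- A quantitative form of the Bernoulli inequality `1 + β (s - 1) ≤ s ^ β` on `(0, 1]`. -/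
lemma rpow_taylor_lower_bound {β s : ℝ} (hβ : 1 < β) (hs : 0 < s) (hs1 : s ≤ 1) :
    β * (β - 1) / 2 * (s ^ β / s) * (1 - s) ^ 2 ≤ s ^ β - β * s + β - 1 := by
  let G : ℝ → ℝ := fun r ↦
    r + r ^ (-β) * (-β * r ^ 2 + (β - 1) * r) - β * (β - 1) / 2 * (1 - r) ^ 2
  have hderiv : ∀ r, 0 < r → HasDerivAt G
      (1 + β * (β - 1) * (1 - r) - (1 + β * (β - 2) * (1 - r)) * r ^ (-β)) r := by
    intro r hr
    have hpow : HasDerivAt (fun x : ℝ ↦ x ^ (-β)) (-β * r ^ (-β - 1)) r :=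
      Real.hasDerivAt_rpow_const (Or.inl hr.ne')
    have hpoly : HasDerivAt (fun x : ℝ ↦ -β * x ^ 2 + (β - 1) * x)
        (-β * (2 * r) + (β - 1)) r := by
      refine (((hasDerivAt_pow 2 r).const_mul (-β)).add
        ((hasDerivAt_id r).const_mul (β - 1))).congr_deriv ?_
      simp
    have hsq : HasDerivAt (fun x : ℝ ↦ β * (β - 1) / 2 * (1 - x) ^ 2)
        (β * (β - 1) / 2 * (2 * (1 - r) * (-1))) r := by
      simpa using (((hasDerivAt_id r).const_sub 1).pow 2).const_mul (β * (β - 1) / 2)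
    refine (((hasDerivAt_id r).add (hpow.mul hpoly)).sub hsq).congr_deriv ?_
    rw [Real.rpow_sub_one hr.ne']
    field_simp
    ring
  have hanti : AntitoneOn G (Set.Icc s 1) := by
    refine antitoneOn_of_deriv_nonpos (convex_Icc s 1)
      (fun r hr ↦ (hderiv r (hs.trans_le hr.1)).continuousAt.continuousWithinAt) ?_ ?_
    · intro r hr
      rw [interior_Icc] at hr
      exact (hderiv r (hs.trans hr.1)).differentiableAt.differentiableWithinAt
    · intro r hr
      rw [interior_Icc] at hr
      rw [(hderiv r (hs.trans hr.1)).deriv]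
      linarith [one_add_le_mul_rpow_neg hβ (hs.trans hr.1) hr.2.le]
  have hG : G 1 ≤ G s := hanti ⟨le_rfl, hs1⟩ ⟨hs1, le_rfl⟩ hs1
  have hG1 : G 1 = 0 := by
    simp only [G, Real.one_rpow]
    ring
  have hpos : 0 < s ^ β := Real.rpow_pos_of_pos hs β
  have hGs : s ^ β / s * G s
      = s ^ β - β * s + β - 1 - β * (β - 1) / 2 * (s ^ β / s) * (1 - s) ^ 2 := by
    simp only [G, Real.rpow_neg hs.le]
    field_simp
    ring
  have : 0 ≤ s ^ β / s * G s := mul_nonneg (by positivity) (hG1 ▸ hG)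
  linarith

/-- inequality (3.8) of the paper: with `4(p+1)b₀ ≤ α(α−2)c₀`,
`0 ≤ b ≤ b₀`, `c ≥ c₀` and `λ₀ = (c₀/c)^{1/α}`, one has
`(p+1)(λ₀² + λ₀⁻² − 2)b ≤ (2λ₀^α − αλ₀² + α − 2)c`. -/
theorem stmt7 (p α b₀ c₀ b c lam₀ : ℝ) (hp : 1 < p) (hα : 2 < α)
    (hb₀ : 0 < b₀) (hc₀ : 0 < c₀)
    (hkey : 4 * (p + 1) * b₀ ≤ α * (α - 2) * c₀)
    (hb : 0 ≤ b) (hbb₀ : b ≤ b₀) (hc : c₀ ≤ c)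
    (hlam₀ : lam₀ = (c₀ / c) ^ (1 / α)) :
    (p + 1) * (lam₀ ^ 2 + (lam₀ ^ 2)⁻¹ - 2) * b
      ≤ (2 * lam₀ ^ α - α * lam₀ ^ 2 + α - 2) * c := by
  have hc_pos : 0 < c := hc₀.trans_le hc
  have hratio : 0 < c₀ / c := div_pos hc₀ hc_pos
  have hlam_pos : 0 < lam₀ := hlam₀ ▸ Real.rpow_pos_of_pos hratio _
  have hlam_le : lam₀ ≤ 1 := hlam₀ ▸ Real.rpow_le_one hratio.le
    ((div_le_one hc_pos).mpr hc) (by positivity)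
  have hlam_pow : lam₀ ^ α = c₀ / c := by
    rw [hlam₀, one_div, Real.rpow_inv_rpow hratio.le (by positivity)]
  have hsq_pow : (lam₀ ^ 2) ^ (α / 2) = lam₀ ^ α := by
    rw [← Real.rpow_natCast, ← Real.rpow_mul hlam_pos.le]
    congr 1
    push_cast
    ring
  have hs : 0 < lam₀ ^ 2 := by positivity
  have hbound := rpow_taylor_lower_bound (β := α / 2) (by linarith) hs
    (pow_le_one₀ hlam_pos.le hlam_le)
  rw [hsq_pow] at hbound
  generalize lam₀ ^ 2 = s at hs hbound ⊢
  have hsum : s + s⁻¹ - 2 = (1 - s) ^ 2 / s := by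
    field_simp
    ring
  have hcoeff : (p + 1) * b ≤ α * (α - 2) / 4 * c₀ := by
    nlinarith [mul_le_mul_of_nonneg_left hbb₀ (by linarith : 0 ≤ p + 1)]
  calc (p + 1) * (s + s⁻¹ - 2) * b = (p + 1) * b * ((1 - s) ^ 2 / s) := by rw [hsum]; ring
    _ ≤ α * (α - 2) / 4 * c₀ * ((1 - s) ^ 2 / s) :=
        mul_le_mul_of_nonneg_right hcoeff (by positivity)
    _ = 2 * (α / 2 * (α / 2 - 1) / 2 * (lam₀ ^ α / s) * (1 - s) ^ 2) * c := by
        rw [hlam_pow]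
        field_simp
        ring
    _ ≤ 2 * (lam₀ ^ α - α / 2 * s + α / 2 - 1) * c := by gcongr
    _ = (2 * lam₀ ^ α - α * s + α - 2) * c := by ring
end

section
/- Let p > 1 and α > 2 be real numbers. Let a₀, b₀, c₀ > 0 be real numbers satisfying a₀/2 − b₀/2 − α c₀/(2(p+1)) = 0 and a₀ + 3b₀ − α(α−1)c₀/(p+1) ≤ 0. Let a, b, c ≥ 0 be real numbers with c > c₀ and a/2 − b/2 − α c/(2(p+1)) ≤ 0, and set λ₀ = (c₀/c)^{1/α} and e(λ₀) = λ₀²a/2 + λ₀⁻²b/2 − λ₀^α c/(p+1). Assume that b ≥ b₀ or that a₀/2 + b₀/2 − c₀/(p+1) ≤ e(λ₀). Then a₀/2 + b₀/2 − c₀/(p+1) ≤ (a/2 + b/2 − c/(p+1)) − (a/2 − b/2 − α c/(2(p+1))); that is, E(a₀,b₀,c₀) ≤ E(a,b,c) − P(a,b,c). -/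
theorem nonneg_of_hasDerivAt_nonneg {f f' : ℝ → ℝ} {x₀ : ℝ} (h₀ : f x₀ = 0)
    (hf : ∀ x, x₀ ≤ x → HasDerivAt f (f' x) x) (hf' : ∀ x, x₀ ≤ x → 0 ≤ f' x)
    {y : ℝ} (hy : x₀ ≤ y) : 0 ≤ f y := by
  have hmono : MonotoneOn f (Set.Ici x₀) := by
    refine monotoneOn_of_hasDerivWithinAt_nonneg (f' := f') (convex_Ici x₀)
      (fun x hx => (hf x hx).continuousAt.continuousWithinAt) (fun x hx => ?_) (fun x hx => ?_)
    · exact (hf x (interior_subset hx)).hasDerivWithinAt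
    · exact hf' x (interior_subset hx)
  exact h₀ ▸ hmono Set.self_mem_Ici hy hy

theorem two_mul_rpow_sub_add_sq_le {g y : ℝ} (hg : 1 < g) (hy : 1 ≤ y) :
    2 * g * (y ^ g - y) + g * (g - 1) * (y - 1) ^ 2 ≤ (y ^ 2 + 1) * (g - 1) * (y ^ g - 1) := by
  have hd (r x : ℝ) (hx : 1 ≤ x) : HasDerivAt (fun z : ℝ => z ^ r) (r * x ^ (r - 1)) x :=
    Real.hasDerivAt_rpow_const (Or.inl (by linarith))
  have first_deriv_nonneg (x : ℝ) (hx : 1 ≤ x) :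
      0 ≤ (g - 1) * ((g + 2) * x ^ (g + 1)) - (g + 1) * (g * x ^ (g - 1))
        - 2 * (g - 1) * (g + 1) * x + 2 * g ^ 2 := by
    refine nonneg_of_hasDerivAt_nonneg
      (f := fun x => (g - 1) * ((g + 2) * x ^ (g + 1)) - (g + 1) * (g * x ^ (g - 1))
        - 2 * (g - 1) * (g + 1) * x + 2 * g ^ 2)
      (f' := fun x => (g - 1) * ((g + 2) * ((g + 1) * x ^ (g + 1 - 1)))
        - (g + 1) * (g * ((g - 1) * x ^ (g - 1 - 1))) - 2 * (g - 1) * (g + 1) * 1)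
      (by simp only [Real.one_rpow]; ring) (fun x hx => ?_) (fun x hx => ?_) hx
    · exact (((((hd (g + 1) x hx).const_mul _).const_mul _).sub
        (((hd (g - 1) x hx).const_mul _).const_mul _)).sub
          ((hasDerivAt_id x).const_mul _)).add_const _
    · have h1 : 1 ≤ x ^ g := Real.one_le_rpow hx (by linarith)
      have h2 : x ^ (g - 1 - 1) ≤ x ^ g := Real.rpow_le_rpow_of_exponent_le hx (by linarith)
      have h3 : 0 ≤ (g - 1) * (g + 1) * (2 * (x ^ g - 1) + g * (x ^ g - x ^ (g - 1 - 1))) :=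
        mul_nonneg (mul_nonneg (by linarith) (by linarith))
          (add_nonneg (by linarith) (mul_nonneg (by linarith) (by linarith)))
      rw [add_sub_cancel_right]
      linarith
  have key : 0 ≤ (g - 1) * y ^ (g + 2) - (g + 1) * y ^ g
      - (g - 1) * (g + 1) * y ^ 2 + 2 * g ^ 2 * y - (g - 1) * (g + 1) := by
    refine nonneg_of_hasDerivAt_nonneg
      (f := fun x => (g - 1) * x ^ (g + 2) - (g + 1) * x ^ g
        - (g - 1) * (g + 1) * x ^ 2 + 2 * g ^ 2 * x - (g - 1) * (g + 1))
      (by simp only [Real.one_rpow]; ring) (fun x hx => ?_) first_deriv_nonneg hy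
    refine ((((((hd (g + 2) x hx).const_mul (g - 1)).sub
      ((hd g x hx).const_mul (g + 1))).sub ((hasDerivAt_pow 2 x).const_mul
        ((g - 1) * (g + 1)))).add ((hasDerivAt_id x).const_mul (2 * g ^ 2))).sub_const
          ((g - 1) * (g + 1))).congr_deriv ?_
    rw [show g + 2 - 1 = g + 1 by ring]
    push_cast
    ring
  have hpow : y ^ (g + 2) = y ^ g * y ^ 2 := by
    rw [Real.rpow_add (by linarith), Real.rpow_two]
  rw [hpow] at key
  linarith


/-- scalar content of Lemma 3.3: if the ground-state quantities
`(a₀,b₀,c₀)` satisfy `P(a₀,b₀,c₀) = 0` and `R(a₀,b₀,c₀) ≤ 0`, and `(a,b,c)` satisfy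
`c > c₀` and `P(a,b,c) ≤ 0`, with `λ₀ = (c₀/c)^{1/α}`; and if moreover `b ≥ b₀` or
`E(a₀,b₀,c₀) ≤ e(λ₀)`, then `E(a₀,b₀,c₀) ≤ E(a,b,c) − P(a,b,c)`. -/
theorem stmt11 (p α a₀ b₀ c₀ a b c lam₀ : ℝ) (hp : 1 < p) (hα : 2 < α)
    (ha₀ : 0 < a₀) (hb₀ : 0 < b₀) (hc₀ : 0 < c₀)
    (hP₀ : a₀ / 2 - b₀ / 2 - α * c₀ / (2 * (p + 1)) = 0)
    (hR₀ : a₀ + 3 * b₀ - α * (α - 1) * c₀ / (p + 1) ≤ 0)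
    (ha : 0 ≤ a) (hb : 0 ≤ b) (hc : 0 ≤ c) (hcc₀ : c₀ < c)
    (hP : a / 2 - b / 2 - α * c / (2 * (p + 1)) ≤ 0)
    (hlam₀ : lam₀ = (c₀ / c) ^ (1 / α))
    (hcase : b₀ ≤ b ∨
      a₀ / 2 + b₀ / 2 - c₀ / (p + 1)
        ≤ lam₀ ^ 2 * a / 2 + (lam₀ ^ 2)⁻¹ * b / 2 - lam₀ ^ α * c / (p + 1)) :
    a₀ / 2 + b₀ / 2 - c₀ / (p + 1)
      ≤ (a / 2 + b / 2 - c / (p + 1))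
        - (a / 2 - b / 2 - α * c / (2 * (p + 1))) := by
  have hp1 : 0 < p + 1 := by linarith
  have hc' : 0 < c := hc₀.trans hcc₀
  have hr : 0 < c₀ / c := div_pos hc₀ hc'
  have hlpos : 0 < lam₀ := hlam₀ ▸ Real.rpow_pos_of_pos hr _
  have hlα : lam₀ ^ α = c₀ / c := by
    rw [hlam₀, ← Real.rpow_mul hr.le, one_div_mul_cancel (by linarith), Real.rpow_one]
  have hl1 : lam₀ ≤ 1 := hlam₀ ▸ Real.rpow_le_one hr.le
    ((div_le_one hc').2 hcc₀.le) (by positivity)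
  obtain ⟨y, hy⟩ : ∃ y, y = (lam₀ ^ 2)⁻¹ := ⟨_, rfl⟩
  have hl2 : lam₀ ^ 2 = y⁻¹ := by rw [hy, inv_inv]
  have hy1 : 1 ≤ y := hy ▸ (one_le_inv₀ (by positivity)).2 (pow_le_one₀ hlpos.le hl1)
  have hyα : y ^ (α / 2) = c / c₀ := by
    rw [hy, Real.inv_rpow (by positivity), ← Real.rpow_two, ← Real.rpow_mul hlpos.le,
      mul_div_cancel₀ _ two_ne_zero, hlα, inv_div]
  have hkey := two_mul_rpow_sub_add_sq_le (g := α / 2) (by linarith) hy1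
  rw [hyα] at hkey
  obtain ⟨Y, hY⟩ : ∃ Y, Y = c / c₀ := ⟨_, rfl⟩
  obtain ⟨k, hk⟩ : ∃ k, k = c₀ / (p + 1) := ⟨_, rfl⟩
  have hkpos : 0 < k := hk ▸ div_pos hc₀ hp1
  have hY1 : 1 < Y := hY ▸ (one_lt_div hc₀).2 hcc₀
  have hcY : c / (p + 1) = Y * k := by rw [hY, hk]; field_simp
  have e1 : α * c₀ / (2 * (p + 1)) = α / 2 * k := by rw [hk]; field_simp
  have e2 : α * c / (2 * (p + 1)) = α / 2 * (Y * k) := by rw [← hcY]; field_simp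
  have e3 : α * (α - 1) * c₀ / (p + 1) = α * (α - 1) * k := by rw [hk]; field_simp
  have e4 : lam₀ ^ α * c / (p + 1) = k := by rw [hlα, hk]; field_simp
  rw [e4, ← hy, hl2, ← hk] at hcase
  rw [e1] at hP₀
  rw [e2] at hP
  rw [e3] at hR₀
  rw [← hY] at hkey
  rw [e2, hcY, ← hk]
  have hYk : 0 ≤ (α / 2 - 1) * ((Y - 1) * k) :=
    mul_nonneg (by linarith) (mul_nonneg (by linarith) hkpos.le)
  rcases hcase with hbb | hE
  · linarith
  · by_contra! hlt
    have hy0 : 0 < y := by linarith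
    have hscaled : 2 * y * b₀ + α * y * k ≤ (1 + y ^ 2) * b + α * (Y * k) := by
      have h1 : y⁻¹ * a / 2 ≤ y⁻¹ * (b + α * (Y * k)) / 2 := by
        gcongr
        linarith
      have h2 : b₀ + α / 2 * k ≤ y⁻¹ * (b + α * (Y * k)) / 2 + y * b / 2 := by linarith
      have h3 := mul_le_mul_of_nonneg_left h2 (by linarith : 0 ≤ 2 * y)
      have h4 : 2 * y * (y⁻¹ * (b + α * (Y * k)) / 2 + y * b / 2)
          = (1 + y ^ 2) * b + α * (Y * k) := by
        field_simp
        ring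
      linarith
    have hb_lt : b < b₀ - (α / 2 - 1) * ((Y - 1) * k) := by linarith
    have h5 := mul_lt_mul_of_pos_left hb_lt (by positivity : 0 < 1 + y ^ 2)
    have hb₀_le : b₀ ≤ α / 2 * (α / 2 - 1) * k := by linarith
    have h6 := mul_le_mul_of_nonneg_left hb₀_le (sq_nonneg (y - 1))
    have h7 := mul_le_mul_of_nonneg_right hkey hkpos.le
    linarith
end
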